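/- arXiv:2403.11633 — 2 statements merged into one kernel-verified Lean document; each statement's English description precedes it below -/
import Mathlib

section
/- Every CE-game (N, v) is totally balanced: for every nonempty coalition T ⊆ N there exists an allocation x : N → ℝ such that ∑_{i∈T} x i = v(T) and ∑_{i∈S} x i ≥ v(S) for every S ⊆ T; that is, the core of every subgame of a CE-game is nonempty. -/
open Finset

noncomputable section

variable {ι : Type*}

/-- Full capacity margin `Δ i`. -/
def Dm (Q c : ι → ℝ) (p : ℝ) (i : ι) : ℝ := Q i * p - c i

/-- Under-supply adjusted margin `δ i`. -/
def dm (Q c : ι → ℝ) (p ru : ℝ) (i : ι) : ℝ := Q i * (p + ru) - c i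

/-- Essential players of a coalition `S`. -/
def SE [DecidableEq ι] (Q c : ι → ℝ) (p : ℝ) (S : Finset ι) : Finset ι :=
  S.filter fun i => 0 ≤ Dm Q c p i

/-- Potential players of a coalition `S`. -/
def SP [DecidableEq ι] (Q c : ι → ℝ) (p ru : ℝ) (S : Finset ι) : Finset ι :=
  S.filter fun i => 0 ≤ dm Q c p ru i

/-- Complementary players of a coalition `S`. -/
def SC [DecidableEq ι] (Q c : ι → ℝ) (p ru : ℝ) (S : Finset ι) : Finset ι :=
  SP Q c p ru S \ SE Q c p S

/-- Profit `π(R)` of an exporter set `R` (with `π(∅) = 0`). -/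
def piR [DecidableEq ι] (Q c : ι → ℝ) (p ru mq : ℝ) (R : Finset ι) : ℝ :=
  if R = ∅ then 0 else (∑ i ∈ R, Dm Q c p i) - max (mq - ∑ i ∈ R, Q i) 0 * ru

/-- The CE-game: `v(S)` is the maximum of `π` over all subsets of `S`. -/
def vG [DecidableEq ι] (Q c : ι → ℝ) (p ru mq : ℝ) (S : Finset ι) : ℝ :=
  S.powerset.sup' (Finset.powerset_nonempty S) (piR Q c p ru mq)

/-- `G^S(D)`: contribution of a set `D` of complementary players in coalition `S`. -/
def GS [DecidableEq ι] (Q c : ι → ℝ) (p ru mq : ℝ) (S D : Finset ι) : ℝ :=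
  (∑ i ∈ D, Dm Q c p i) + min (mq - ∑ i ∈ SE Q c p S, Q i) (∑ i ∈ D, Q i) * ru

/-- The NEA (Non-essential Exporter Altruistic) allocation. -/
def NEA [DecidableEq ι] (Q c : ι → ℝ) (p ru mq : ℝ) (N : Finset ι) (i : ι) : ℝ :=
  if i ∈ SE Q c p N then (Dm Q c p i / ∑ j ∈ SE Q c p N, Dm Q c p j) * vG Q c p ru mq N
  else 0

/-- Excess of a coalition `S` with respect to the NEA allocation of the game on `N`. -/
def exc [DecidableEq ι] (Q c : ι → ℝ) (p ru mq : ℝ) (N S : Finset ι) : ℝ :=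
  (∑ i ∈ S, NEA Q c p ru mq N i) - vG Q c p ru mq S

/-- The total full capacity margin of the essential players of `S`. -/
def essentialMargin (Q c : ι → ℝ) (p : ℝ) (S : Finset ι) : ℝ :=
  ∑ i ∈ S, max (Dm Q c p i) 0

lemma essentialMargin_nonneg (Q c : ι → ℝ) (p : ℝ) (S : Finset ι) :
    0 ≤ essentialMargin Q c p S :=
  sum_nonneg fun _ _ => le_max_right _ _

lemma essentialMargin_mono (Q c : ι → ℝ) (p : ℝ) {S T : Finset ι} (h : S ⊆ T) :
    essentialMargin Q c p S ≤ essentialMargin Q c p T :=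
  sum_le_sum_of_subset_of_nonneg h fun _ _ _ => le_max_right _ _

lemma piR_le_vG [DecidableEq ι] (Q c : ι → ℝ) (p ru mq : ℝ) {R S : Finset ι} (h : R ⊆ S) :
    piR Q c p ru mq R ≤ vG Q c p ru mq S :=
  le_sup' (piR Q c p ru mq) (mem_powerset.2 h)

lemma vG_nonneg [DecidableEq ι] (Q c : ι → ℝ) (p ru mq : ℝ) (S : Finset ι) :
    0 ≤ vG Q c p ru mq S := by
  simpa [piR] using piR_le_vG Q c p ru mq (empty_subset S)

lemma piR_le_essentialMargin [DecidableEq ι] (Q c : ι → ℝ) (p mq : ℝ) {ru : ℝ} (hru : 0 ≤ ru)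
    (R : Finset ι) : piR Q c p ru mq R ≤ essentialMargin Q c p R := by
  unfold piR
  split_ifs
  · exact essentialMargin_nonneg Q c p R
  · have h : ∑ i ∈ R, Dm Q c p i ≤ essentialMargin Q c p R :=
      sum_le_sum fun _ _ => le_max_left _ _
    have := mul_nonneg (le_max_right (mq - ∑ i ∈ R, Q i) 0) hru
    linarith

lemma vG_le_essentialMargin [DecidableEq ι] (Q c : ι → ℝ) (p mq : ℝ) {ru : ℝ} (hru : 0 ≤ ru)
    (S : Finset ι) : vG Q c p ru mq S ≤ essentialMargin Q c p S :=
  sup'_le _ _ fun R hR => (piR_le_essentialMargin Q c p mq hru R).trans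
    (essentialMargin_mono Q c p (mem_powerset.1 hR))

lemma sum_Dm_union_SE [DecidableEq ι] (Q c : ι → ℝ) (p : ℝ) {R T : Finset ι} (h : R ⊆ T) :
    ∑ i ∈ R ∪ SE Q c p T, Dm Q c p i
      = essentialMargin Q c p T + ∑ i ∈ R, min (Dm Q c p i) 0 := by
  have hpos : essentialMargin Q c p T = ∑ i ∈ R ∪ SE Q c p T, max (Dm Q c p i) 0 := by
    refine (sum_subset (union_subset h (filter_subset _ _)) fun i hi hn => ?_).symm
    simp only [mem_union, mem_filter, not_or, not_and, not_le] at hn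
    exact max_eq_right (hn.2 hi).le
  have hneg : ∑ i ∈ R, min (Dm Q c p i) 0 = ∑ i ∈ R ∪ SE Q c p T, min (Dm Q c p i) 0 := by
    refine sum_subset subset_union_left fun i hi hn => ?_
    simp only [SE, mem_union, mem_filter] at hi
    exact min_eq_right (hi.resolve_left hn).2
  rw [hpos, hneg, ← sum_add_distrib]
  exact sum_congr rfl fun i _ => by rw [max_add_min, add_zero]

lemma essentialMargin_mul_piR_le [DecidableEq ι] {Q c : ι → ℝ} {p ru mq : ℝ} (hru : 0 ≤ ru)
    {R S T : Finset ι} (hRS : R ⊆ S) (hST : S ⊆ T) (hQ : ∀ i ∈ T, 0 ≤ Q i) :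
    essentialMargin Q c p T * piR Q c p ru mq R
      ≤ essentialMargin Q c p S * vG Q c p ru mq T := by
  have hS := essentialMargin_nonneg Q c p S
  have hle := essentialMargin_mono Q c p hST
  rcases R.eq_empty_or_nonempty with rfl | hR
  · simpa [piR] using mul_nonneg hS (vG_nonneg Q c p ru mq T)
  have hsub : R ∪ SE Q c p T ⊆ T := union_subset (hRS.trans hST) (filter_subset _ _)
  set m := max (mq - ∑ i ∈ R ∪ SE Q c p T, Q i) 0 * ru with hm
  set K := m - ∑ i ∈ R, min (Dm Q c p i) 0 with hK
  have hK0 : 0 ≤ K := by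
    have h₁ : 0 ≤ m := mul_nonneg (le_max_right _ _) hru
    have h₂ : ∑ i ∈ R, min (Dm Q c p i) 0 ≤ 0 := sum_nonpos fun _ _ => min_le_right _ _
    linarith
  have hv : essentialMargin Q c p T - K ≤ vG Q c p ru mq T := by
    have h := piR_le_vG Q c p ru mq hsub
    rw [piR, if_neg (hR.mono subset_union_left).ne_empty,
      sum_Dm_union_SE Q c p (hRS.trans hST)] at h
    linarith
  have hpi : piR Q c p ru mq R ≤ essentialMargin Q c p S - K := by
    have hsum : ∑ i ∈ R, Dm Q c p i
        = essentialMargin Q c p R + ∑ i ∈ R, min (Dm Q c p i) 0 := by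
      rw [essentialMargin, ← sum_add_distrib]
      exact sum_congr rfl fun i _ => by rw [max_add_min, add_zero]
    have hcap : ∑ i ∈ R, Q i ≤ ∑ i ∈ R ∪ SE Q c p T, Q i :=
      sum_le_sum_of_subset_of_nonneg subset_union_left fun i hi _ => hQ i (hsub hi)
    have hpen : m ≤ max (mq - ∑ i ∈ R, Q i) 0 * ru :=
      mul_le_mul_of_nonneg_right (max_le_max_right 0 (sub_le_sub_left hcap mq)) hru
    have := essentialMargin_mono Q c p hRS
    rw [piR, if_neg hR.ne_empty, hsum]
    linarith
  calc essentialMargin Q c p T * piR Q c p ru mq R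
      ≤ essentialMargin Q c p T * (essentialMargin Q c p S - K) :=
        mul_le_mul_of_nonneg_left hpi (hS.trans hle)
    _ ≤ essentialMargin Q c p S * (essentialMargin Q c p T - K) := by
        nlinarith [mul_nonneg hK0 (sub_nonneg.2 hle)]
    _ ≤ essentialMargin Q c p S * vG Q c p ru mq T := mul_le_mul_of_nonneg_left hv hS

/-- every CE-game is totally balanced: for every nonempty coalition
`T ⊆ N` there is an allocation `x` with `∑_{i ∈ T} x i = v(T)` and
`∑_{i ∈ S} x i ≥ v(S)` for every `S ⊆ T`, i.e. the core of every subgame is nonempty. -/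
theorem ce_game_totally_balanced [DecidableEq ι]
    (N : Finset ι) (hN : N.Nonempty) (Q c : ι → ℝ) (p ru mq : ℝ)
    (hQ : ∀ i ∈ N, 0 < Q i) (hc : ∀ i ∈ N, 0 ≤ c i)
    (hp : 0 ≤ p) (hru : 0 ≤ ru) (hmq : 0 < mq)
    (hQmq : ∀ i ∈ N, Q i < mq)
    (T : Finset ι) (hT : T ⊆ N) (hTne : T.Nonempty) :
    ∃ x : ι → ℝ, (∑ i ∈ T, x i = vG Q c p ru mq T) ∧
      ∀ S ⊆ T, vG Q c p ru mq S ≤ ∑ i ∈ S, x i := by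
  rcases (essentialMargin_nonneg Q c p T).eq_or_lt with hA | hA
  · refine ⟨0, ?_, fun S hS => ?_⟩
    · have h := vG_le_essentialMargin Q c p mq hru T
      simpa using le_antisymm (vG_nonneg Q c p ru mq T) (h.trans hA.ge)
    · simpa using (vG_le_essentialMargin Q c p mq hru S).trans
        ((essentialMargin_mono Q c p hS).trans hA.ge)
  · have hsum (S : Finset ι) :
        ∑ i ∈ S, max (Dm Q c p i) 0 * (vG Q c p ru mq T / essentialMargin Q c p T)
          = essentialMargin Q c p S * vG Q c p ru mq T / essentialMargin Q c p T := by
      rw [← sum_mul, mul_div_assoc, ← essentialMargin]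
    refine ⟨fun i => max (Dm Q c p i) 0 * (vG Q c p ru mq T / essentialMargin Q c p T),
      ?_, fun S hS => ?_⟩
    · rw [hsum, mul_div_cancel_left₀ _ hA.ne']
    · rw [hsum]
      refine sup'_le _ _ fun R hR => ?_
      rw [le_div_iff₀' hA]
      exact essentialMargin_mul_piR_le hru (mem_powerset.1 hR) hS fun i hi => (hQ i (hT hi)).le

end
end

section
/- Let (N, v) be a CE-game with ∑_{j∈N^E} Δ j > 0 and ∑_{i∈N^E} Q i < mq, let φ be the NEA allocation and e(S, φ) := ∑_{i∈S} φ i − v(S) the excess. Let D^N ⊆ N^C be a maximizer of G^N over subsets of N^C and assume D^N ≠ ∅. Let α : D^N → ℝ be nonnegative weights with ∑_{j∈D^N} α j > 0. For ρ ≥ 0 define the egalitarian essential rate allocation ψ^ρ by ψ^ρ_i := φ_i − ρ for i ∈ N^E, ψ^ρ_i := (α_i / ∑_{j∈D^N} α_j) * |N^E| * ρ for i ∈ D^N, and ψ^ρ_i := 0 otherwise. If 0 ≤ ρ ≤ min over proper coalitions S ⊊ N with S^E ≠ ∅ of e(S, φ)/|S^E|, then ψ^ρ is in the core of (N, v): ∑_{i∈N}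 ψ^ρ_i = v(N) and ∑_{i∈S} ψ^ρ_i ≥ v(S) for every S ⊆ N. -/
open Finset

noncomputable section

variable {ι : Type*}

/-- A coalition without essential players has worth at most zero. -/
theorem vG_nonpos_of_SE_eq_empty [DecidableEq ι] {Q c : ι → ℝ} {p ru mq : ℝ} (hru : 0 ≤ ru)
    {S : Finset ι} (hS : SE Q c p S = ∅) : vG Q c p ru mq S ≤ 0 := by
  refine Finset.sup'_le _ _ fun R hR => ?_
  unfold piR
  split_ifs
  · exact le_rfl
  · have hsum : ∑ i ∈ R, Dm Q c p i ≤ 0 := Finset.sum_nonpos fun i hi =>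
      (not_le.mp (Finset.filter_eq_empty_iff.mp hS (Finset.mem_powerset.mp hR hi))).le
    have hpen : 0 ≤ max (mq - ∑ i ∈ R, Q i) 0 * ru := mul_nonneg (le_max_right _ _) hru
    linarith

/-- The NEA allocation is efficient. -/
theorem sum_NEA [DecidableEq ι] {Q c : ι → ℝ} {p ru mq : ℝ} {N : Finset ι}
    (hsum : ∑ j ∈ SE Q c p N, Dm Q c p j ≠ 0) :
    ∑ i ∈ N, NEA Q c p ru mq N i = vG Q c p ru mq N := by
  have hsub : SE Q c p N ⊆ N := Finset.filter_subset _ _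
  simp only [NEA]
  rw [Finset.sum_ite_mem, Finset.inter_eq_right.mpr hsub, ← Finset.sum_mul, ← Finset.sum_div,
    div_self hsum, one_mul]

/-- The essential players of a subcoalition are its members that are essential in `N`. -/
theorem inter_SE_of_subset [DecidableEq ι] {Q c : ι → ℝ} {p : ℝ} {S N : Finset ι} (h : S ⊆ N) :
    S ∩ SE Q c p N = SE Q c p S := by
  rw [SE, SE, Finset.inter_filter, Finset.inter_eq_left.mpr h]

/-- egalitarian essential rate rule. With `N^E ≠ ∅`,
`∑_{j ∈ N^E} Δ j > 0`, `∑_{i ∈ N^E} Q i < mq`, a nonempty maximizer `D^N` of `G^N` over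
subsets of `N^C`, nonnegative weights `α` on `D^N` with positive total, and
`0 ≤ ρ ≤ e(S, φ)/|S^E|` for every proper coalition `S ⊊ N` with `S^E ≠ ∅`, the
allocation `ψ^ρ` (charging `ρ` to each essential player and redistributing to `D^N`
proportionally to `α`) lies in the core of the CE-game. -/
theorem egalitarian_essential_rate_in_core [DecidableEq ι]
    (N : Finset ι) (hN : N.Nonempty) (Q c : ι → ℝ) (p ru mq : ℝ)
    (hQ : ∀ i ∈ N, 0 < Q i) (hc : ∀ i ∈ N, 0 ≤ c i)
    (hp : 0 ≤ p) (hru : 0 ≤ ru) (hmq : 0 < mq)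
    (hQmq : ∀ i ∈ N, Q i < mq)
    (hNE : (SE Q c p N).Nonempty)
    (hsum : 0 < ∑ j ∈ SE Q c p N, Dm Q c p j)
    (hbelow : ∑ i ∈ SE Q c p N, Q i < mq)
    (DN : Finset ι) (hDN : DN ⊆ SC Q c p ru N) (hDNne : DN.Nonempty)
    (hDNmax : ∀ D ⊆ SC Q c p ru N, GS Q c p ru mq N D ≤ GS Q c p ru mq N DN)
    (α : ι → ℝ) (hα : ∀ i ∈ DN, 0 ≤ α i) (hαpos : 0 < ∑ j ∈ DN, α j)
    (ρ : ℝ) (hρ0 : 0 ≤ ρ)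
    (hρ : ∀ S, S ⊆ N → S ≠ N → (SE Q c p S).Nonempty →
      ρ ≤ exc Q c p ru mq N S / ((SE Q c p S).card : ℝ))
    (ψ : ι → ℝ)
    (hψ : ∀ i, ψ i =
      if i ∈ SE Q c p N then NEA Q c p ru mq N i - ρ
      else if i ∈ DN then (α i / ∑ j ∈ DN, α j) * ((SE Q c p N).card : ℝ) * ρ
      else 0) :
    (∑ i ∈ N, ψ i = vG Q c p ru mq N) ∧
    ∀ S ⊆ N, vG Q c p ru mq S ≤ ∑ i ∈ S, ψ i := by
  have hDNE : ∀ i ∈ DN, i ∉ SE Q c p N := fun i hi => (Finset.mem_sdiff.mp (hDN hi)).2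
  have hDNN : DN ⊆ N := fun i hi =>
    (Finset.mem_filter.mp (Finset.mem_sdiff.mp (hDN hi)).1).1
  have hψ_eq : ∀ i, ψ i = NEA Q c p ru mq N i - (if i ∈ SE Q c p N then ρ else 0) +
      (if i ∈ DN then (α i / ∑ j ∈ DN, α j) * ((SE Q c p N).card : ℝ) * ρ else 0) := by
    intro i
    rw [hψ i]
    by_cases hE : i ∈ SE Q c p N
    · have hD : i ∉ DN := fun h => hDNE i h hE
      simp [hE, hD]
    · simp [hE, NEA]
  have htransfer_nonneg : ∀ i, 0 ≤
      (if i ∈ DN then (α i / ∑ j ∈ DN, α j) * ((SE Q c p N).card : ℝ) * ρ else 0) := by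
    intro i
    split_ifs with hi
    · have := hα i hi
      positivity
    · exact le_rfl
  have htotal : ∑ i ∈ N, ψ i = vG Q c p ru mq N := by
    simp_rw [hψ_eq]
    rw [Finset.sum_add_distrib, Finset.sum_sub_distrib, sum_NEA hsum.ne', Finset.sum_ite_mem,
      Finset.sum_ite_mem, inter_SE_of_subset subset_rfl, Finset.inter_eq_right.mpr hDNN,
      ← Finset.sum_mul, ← Finset.sum_mul, ← Finset.sum_div, div_self hαpos.ne',
      Finset.sum_const, nsmul_eq_mul]
    ring
  refine ⟨htotal, fun S hS => ?_⟩
  by_cases hSN : S = N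
  · rw [hSN, htotal]
  have hlower : ∑ i ∈ S, NEA Q c p ru mq N i - ((SE Q c p S).card : ℝ) * ρ ≤ ∑ i ∈ S, ψ i := by
    simp_rw [hψ_eq]
    rw [Finset.sum_add_distrib, Finset.sum_sub_distrib, Finset.sum_ite_mem,
      inter_SE_of_subset hS, Finset.sum_const, nsmul_eq_mul]
    exact le_add_of_nonneg_right (Finset.sum_nonneg fun i _ => htransfer_nonneg i)
  rcases (SE Q c p S).eq_empty_or_nonempty with hE | hE
  · have hφ : ∑ i ∈ S, NEA Q c p ru mq N i = 0 := by
      simp only [NEA]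
      rw [Finset.sum_ite_mem, inter_SE_of_subset hS, hE, Finset.sum_empty]
    rw [hφ, hE] at hlower
    have hv := vG_nonpos_of_SE_eq_empty (mq := mq) hru hE
    simp only [Finset.card_empty, Nat.cast_zero, zero_mul, sub_zero] at hlower
    linarith
  · have hcard : (0 : ℝ) < (SE Q c p S).card := by exact_mod_cast hE.card_pos
    have hexc := (le_div_iff₀ hcard).mp (hρ S hS hSN hE)
    unfold exc at hexc
    linarith
end
end
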